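/- For every real κ > 0, every real v ≥ 0, and every t ∈ [0, 1], one has (1 + v)^{κ+1} ≥ 1 + (κ+1)·t·v + (1 − t)·v^{κ+1}, where powers are real powers. -/

import Mathlib

/-- Inequality (4.2) of the paper: for every `κ > 0`, `v ≥ 0` and `t ∈ [0, 1]`,
`(1 + v)^{κ+1} ≥ 1 + (κ+1) t v + (1 - t) v^{κ+1}` (real powers). -/
theorem convexity_inequality (κ v t : ℝ) (hκ : 0 < κ) (hv : 0 ≤ v)
    (ht0 : 0 ≤ t) (ht1 : t ≤ 1) :
    1 + (κ + 1) * t * v + (1 - t) * v ^ (κ + 1) ≤ (1 + v) ^ (κ + 1) := by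
  have h1 : 1 + (κ + 1) * v ≤ (1 + v) ^ (κ + 1) :=
    one_add_mul_self_le_rpow_one_add (by linarith) (by linarith)
  have h2 : 1 + v ^ (κ + 1) ≤ (1 + v) ^ (κ + 1) := by
    have h := Real.add_rpow_le_rpow_add (p := κ + 1) zero_le_one hv (by linarith)
    rwa [Real.one_rpow] at h
  have h3 := mul_le_mul_of_nonneg_left h1 ht0
  have h4 := mul_le_mul_of_nonneg_left h2 (sub_nonneg.2 ht1)
  linarith
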